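/- Let J be a finite index set and for each j ∈ J let N_j ≥ 1, let Ω_j be the standard symplectic form on ℝ^{2N_j}, and let V_ρ^{(j)}, V_σ^{(j)} be real symmetric 2N_j×2N_j matrices such that V_ρ^{(j)} + iΩ_j is positive semidefinite (as a complex matrix) and V_σ^{(j)} − V_ρ^{(j)} is positive definite. Let V_ρ, V_σ and Ω be the block-diagonal matrices with blocks V_ρ^{(j)}, V_σ^{(j)} and Ω_j respectively. Then the Gaussian measured max-relative entropy is additive over the blocks: sup { (1/2)·ln(det(V_σ + γ)/det(V_ρ + γ)) : γ real symmetric with γ + iΩ positive semidefinite } = Σ_{j∈J} sup { (1/2)·ln(det(V_σ^{(j)} + γ_j)/det(V_ρ^{(j)} + γ_j)) : γ_j real symmetric with γ_j + iΩ_j positive semidefinite }. -/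

import Mathlib

open Matrix
open scoped ComplexOrder

noncomputable section

/-- The standard symplectic form on `ℝ^(2N)`: block diagonal with `N` blocks `[[0,1],[-1,0]]`. -/
def symp (N : ℕ) : Matrix (Fin (2*N)) (Fin (2*N)) ℝ :=
  Matrix.of fun i j =>
    if i.val % 2 = 0 ∧ j.val = i.val + 1 then 1
    else if j.val % 2 = 0 ∧ i.val = j.val + 1 then -1
    else 0

/-- View a real matrix as a complex matrix. -/
def cplx {n : Type*} (M : Matrix n n ℝ) : Matrix n n ℂ :=
  M.map (fun x => (x : ℂ))

/-- `V` is a bona fide quantum covariance matrix w.r.t. the symplectic form `Om`: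
the complex matrix `V + i·Om` is positive semidefinite. -/
def BonaFide {n : Type*} [Fintype n] (V Om : Matrix n n ℝ) : Prop :=
  (cplx V + Complex.I • cplx Om).PosSemidef

/-- The (positive semidefinite) square root of a positive semidefinite real matrix,
via the continuous functional calculus. -/
def msqrt {n : Type*} [Fintype n] [DecidableEq n] (M : Matrix n n ℝ) : Matrix n n ℝ :=
  cfc Real.sqrt M

/-- `X_V = V^{1/2} (I + A⁻²)^{1/2} V^{1/2}` where `A = V^{1/2} Ω V^{1/2}`. -/
def Xmat {n : Type*} [Fintype n] [DecidableEq n] (V Om : Matrix n n ℝ) : Matrix n n ℝ :=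
  msqrt V * msqrt (1 + (msqrt V * Om * msqrt V)⁻¹ * (msqrt V * Om * msqrt V)⁻¹) * msqrt V

/-- The Gaussian measured max-relative entropy determined by covariance matrices `Vρ, Vσ`
and symplectic form `Om`: the supremum over bona fide seeds `γ` of
`(1/2)·ln(det(Vσ+γ)/det(Vρ+γ))`. -/
def GDmax {n : Type*} [Fintype n] [DecidableEq n] (Vρ Vσ Om : Matrix n n ℝ) : ℝ :=
  sSup {x : ℝ | ∃ γ : Matrix n n ℝ, γ.IsSymm ∧ BonaFide γ Om ∧
    x = (1/2) * Real.log ((Vσ + γ).det / (Vρ + γ).det)}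

lemma aux_cplx_add {n : Type*} (A B : Matrix n n ℝ) : cplx (A + B) = cplx A + cplx B := by
  ext i j; simp [cplx]

lemma aux_cplx_sub {n : Type*} (A B : Matrix n n ℝ) : cplx (A - B) = cplx A - cplx B := by
  ext i j; simp [cplx]

lemma aux_cplx_mul {n : Type*} [Fintype n] (A B : Matrix n n ℝ) :
    cplx (A * B) = cplx A * cplx B := by
  ext i j; simp [cplx, Matrix.mul_apply]

lemma aux_symp_transpose (N : ℕ) : (symp N)ᵀ = - symp N := by
  ext i j
  simp only [symp, Matrix.transpose_apply, Matrix.of_apply, Matrix.neg_apply]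
  split_ifs <;> first | omega | simp

lemma aux_symp_sq (N : ℕ) : symp N * symp N = -1 := by
  ext i j
  rw [Matrix.mul_apply]
  rcases Nat.mod_two_eq_zero_or_one i.val with hi | hi
  · have hlt : i.val + 1 < 2 * N := by have := i.isLt; omega
    rw [Finset.sum_eq_single (⟨i.val + 1, hlt⟩ : Fin (2 * N))]
    · by_cases hij : i = j
      · subst hij
        have : (i.val + 1) % 2 ≠ 0 := by omega
        simp [symp, hi]
        omega
      · have h2 : ¬ (i.val = j.val) := fun h => hij (Fin.ext h)
        have : ¬ (j.val % 2 = 0 ∧ i.val + 1 = j.val + 1) := by omega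
        have h3 : ¬ ((i.val + 1) % 2 = 0 ∧ j.val = i.val + 1 + 1) := by omega
        simp only [symp, Matrix.of_apply, Matrix.neg_apply, Matrix.one_apply_ne hij, this, h3,
          if_false]
        simp
    · intro k _ hk
      have hk' : k.val ≠ i.val + 1 := fun h => hk (Fin.ext h)
      have h1 : ¬ (i.val % 2 = 0 ∧ k.val = i.val + 1) := by omega
      have h2 : ¬ (k.val % 2 = 0 ∧ i.val = k.val + 1) := by omega
      simp only [symp, Matrix.of_apply, h1, h2, if_false, zero_mul]
    · simp
  · have hlt : i.val - 1 < 2 * N := by have := i.isLt; omega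
    rw [Finset.sum_eq_single (⟨i.val - 1, hlt⟩ : Fin (2 * N))]
    · have a1 : ¬ (i.val % 2 = 0 ∧ i.val - 1 = i.val + 1) := by omega
      have a2 : ((i.val - 1) % 2 = 0 ∧ i.val = i.val - 1 + 1) := by omega
      by_cases hij : i = j
      · subst hij
        simp only [symp, Matrix.of_apply, Matrix.neg_apply, Matrix.one_apply_eq]
        rw [if_neg a1, if_pos a2, if_pos a2]
        norm_num
      · have h2 : ¬ (i.val = j.val) := fun h => hij (Fin.ext h)
        have : ¬ ((i.val - 1) % 2 = 0 ∧ j.val = i.val - 1 + 1) := by omega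
        have h3 : ¬ (j.val % 2 = 0 ∧ i.val - 1 = j.val + 1) := by omega
        simp only [symp, Matrix.of_apply, Matrix.neg_apply, Matrix.one_apply_ne hij, this, h3,
          if_false]
        simp
    · intro k _ hk
      have hk' : k.val ≠ i.val - 1 := fun h => hk (Fin.ext h)
      have h1 : ¬ (i.val % 2 = 0 ∧ k.val = i.val + 1) := by omega
      have h2 : ¬ (k.val % 2 = 0 ∧ i.val = k.val + 1) := by omega
      simp only [symp, Matrix.of_apply, h1, h2, if_false, zero_mul]
    · simp

lemma aux_bf_neg {n : Type*} [Fintype n] {V Om : Matrix n n ℝ} (hV : V.IsSymm)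
    (hO : Omᵀ = -Om) (h : BonaFide V Om) : (cplx V - Complex.I • cplx Om).PosSemidef := by
  have := h.transpose
  suffices e : cplx V - Complex.I • cplx Om = (cplx V + Complex.I • cplx Om)ᵀ by
    rw [e]; exact this
  ext i j
  have h1 : V j i = V i j := hV.apply i j
  have h2 : Om j i = - Om i j := congrFun (congrFun hO i) j
  simp [cplx, h1, h2, sub_eq_add_neg]

lemma aux_bf_posDef {n : Type*} [Fintype n] [DecidableEq n] {V Om : Matrix n n ℝ}
    (hV : V.IsSymm) (hO : Omᵀ = -Om) (hO2 : Om * Om = -1) (h : BonaFide V Om) :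
    (cplx V).PosDef := by
  have h' := aux_bf_neg hV hO h
  have hs : cplx V = (1/2 : ℝ) • ((cplx V + Complex.I • cplx Om) +
      (cplx V - Complex.I • cplx Om)) := by
    ext i j; simp; ring
  have hps : (cplx V).PosSemidef := by
    rw [hs]; exact (h.add h').smul (by norm_num)
  rw [hps.posDef_iff_isUnit]
  rw [← Matrix.mulVec_injective_iff_isUnit]
  refine (injective_iff_map_eq_zero (Matrix.mulVecLin (cplx V))).2 ?_
  intro x hx
  rw [Matrix.mulVecLin_apply] at hx
  have e1 := h.dotProduct_mulVec_nonneg x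
  have e2 := h'.dotProduct_mulVec_nonneg x
  have e3 : star x ⬝ᵥ (cplx V - Complex.I • cplx Om) *ᵥ x
      = - (star x ⬝ᵥ (cplx V + Complex.I • cplx Om) *ᵥ x) := by
    rw [Matrix.sub_mulVec, Matrix.add_mulVec, hx]; simp
  have e4 : star x ⬝ᵥ (cplx V + Complex.I • cplx Om) *ᵥ x = 0 :=
    le_antisymm (by rw [e3] at e2; exact neg_nonneg.mp e2) e1
  have e5 := (h.dotProduct_mulVec_zero_iff x).1 e4
  rw [Matrix.add_mulVec, hx, zero_add, Matrix.smul_mulVec, smul_eq_zero] at e5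
  have e6 := e5.resolve_left Complex.I_ne_zero
  have e7 : cplx Om * cplx Om = -1 := by
    rw [← aux_cplx_mul, hO2]; ext i j; by_cases hij : i = j <;> simp [cplx, hij]
  have : (cplx Om * cplx Om) *ᵥ x = 0 := by rw [← Matrix.mulVec_mulVec, e6, Matrix.mulVec_zero]
  rw [e7] at this
  simpa [Matrix.neg_mulVec] using this

lemma aux_dot {n : Type*} [Fintype n] (A : Matrix n n ℝ) (x : n → ℝ) :
    star (fun i => (x i : ℂ)) ⬝ᵥ (cplx A) *ᵥ (fun i => (x i : ℂ)) =
      ((star x ⬝ᵥ A *ᵥ x : ℝ) : ℂ) := by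
  simp [dotProduct, Matrix.mulVec, cplx]

lemma aux_real_posDef {n : Type*} [Fintype n] {A : Matrix n n ℝ}
    (h : (cplx A).PosDef) : A.PosDef := by
  refine Matrix.PosDef.of_dotProduct_mulVec_pos ?_ ?_
  · ext i j
    have := congrFun (congrFun h.1 i) j
    simpa [cplx] using this
  · intro x hx
    have := h.dotProduct_mulVec_pos (x := fun i => (x i : ℂ)) (by
      intro h0; apply hx; ext i; simpa using congrFun h0 i)
    rw [aux_dot] at this
    exact_mod_cast this

lemma aux_cplx_posSemidef {n : Type*} [Fintype n] [DecidableEq n] {A : Matrix n n ℝ}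
    (h : A.PosSemidef) : (cplx A).PosSemidef := by
  open scoped MatrixOrder in
  obtain ⟨B, rfl⟩ := CStarAlgebra.nonneg_iff_eq_star_mul_self.mp h.nonneg
  rw [aux_cplx_mul]
  have : cplx (star B) = (cplx B)ᴴ := by ext i j; simp [cplx]
  rw [this]
  exact Matrix.posSemidef_conjTranspose_mul_self _

lemma aux_bd_posSemidef {J : Type*} [Fintype J] [DecidableEq J] {n : J → Type*}
    [∀ j, Fintype (n j)] [∀ j, DecidableEq (n j)] (M : ∀ j, Matrix (n j) (n j) ℂ)
    (h : ∀ j, (M j).PosSemidef) : (Matrix.blockDiagonal' M).PosSemidef := by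
  have : ∀ j, ∃ B, M j = Bᴴ * B := fun j => by
    open scoped MatrixOrder in
    exact CStarAlgebra.nonneg_iff_eq_star_mul_self.mp (h j).nonneg
  choose B hB using this
  have : M = fun j => (B j)ᴴ * B j := funext hB
  rw [this, Matrix.blockDiagonal'_mul, ← Matrix.blockDiagonal'_conjTranspose]
  exact Matrix.posSemidef_conjTranspose_mul_self _

lemma aux_bd_bf {J : Type*} [Fintype J] [DecidableEq J] {n : J → Type*}
    [∀ j, Fintype (n j)] [∀ j, DecidableEq (n j)] (M O : ∀ j, Matrix (n j) (n j) ℝ)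
    (h : ∀ j, BonaFide (M j) (O j)) :
    BonaFide (Matrix.blockDiagonal' M) (Matrix.blockDiagonal' O) := by
  have := aux_bd_posSemidef _ h
  unfold BonaFide
  convert this using 1
  ext ⟨i, a⟩ ⟨j, b⟩
  by_cases hij : i = j
  · subst hij; simp [cplx]
  · simp [cplx, Matrix.blockDiagonal'_apply_ne _ _ _ hij]

/-- Schur complement step. -/
lemma aux_schur {m p : Type*} [Fintype m] [Fintype p] [DecidableEq m] [DecidableEq p]
    (A : Matrix m m ℝ) (C : Matrix m p ℝ) (B : Matrix p p ℝ) (O1 : Matrix m m ℝ)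
    (O2 W : Matrix p p ℝ) (hA : A.IsSymm)
    (hbf : BonaFide (fromBlocks A C Cᵀ B) (fromBlocks O1 0 0 O2))
    (hD : (cplx (W + B)).PosDef) (hW : (cplx W - Complex.I • cplx O2).PosSemidef) :
    ∃ γ : Matrix m m ℝ, γ.IsSymm ∧ BonaFide γ O1 ∧ ∃ d : ℝ, 0 < d ∧
      ∀ V : Matrix m m ℝ, (fromBlocks V 0 0 W + fromBlocks A C Cᵀ B).det = d * (V + γ).det := by
  have hDr := aux_real_posDef hD
  have hsD : (W + B)ᵀ = W + B := hDr.1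
  let : Invertible (W + B) := hDr.isUnit.invertible
  let : Invertible (cplx (W + B)) := hD.isUnit.invertible
  refine ⟨A - C * (W + B)⁻¹ * Cᵀ, ?_, ?_, (W + B).det, hDr.det_pos, ?_⟩
  · unfold Matrix.IsSymm
    rw [Matrix.transpose_sub, hA, Matrix.transpose_mul, Matrix.transpose_mul,
      Matrix.transpose_transpose, Matrix.transpose_nonsing_inv, hsD, Matrix.mul_assoc]
  · have h1 : (fromBlocks (0 : Matrix m m ℂ) 0 0
        (cplx W - Complex.I • cplx O2)).PosSemidef := by
      have : fromBlocks (0 : Matrix m m ℂ) 0 0 (cplx W - Complex.I • cplx O2) =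
          (fromCols (0 : Matrix p m ℂ) (1 : Matrix p p ℂ))ᴴ * (cplx W - Complex.I • cplx O2) *
            fromCols (0 : Matrix p m ℂ) (1 : Matrix p p ℂ) := by
        rw [Matrix.conjTranspose_fromCols_eq_fromRows_conjTranspose, Matrix.fromRows_mul,
          Matrix.fromRows_mul_fromCols]
        simp
      rw [this]
      exact hW.conjTranspose_mul_mul_same _
    have h2 := hbf.add h1
    have h3 : cplx (fromBlocks A C Cᵀ B) + Complex.I • cplx (fromBlocks O1 0 0 O2) +
        fromBlocks (0 : Matrix m m ℂ) 0 0 (cplx W - Complex.I • cplx O2) =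
        fromBlocks (cplx A + Complex.I • cplx O1) (C.map (fun x => (x : ℂ)))
          (C.map (fun x => (x : ℂ)))ᴴ (cplx (W + B)) := by
      ext i j
      rcases i with i | i <;> rcases j with j | j <;> simp [cplx, add_comm]
    rw [h3, Matrix.PosDef.fromBlocks₂₂ _ _ hD] at h2
    have hinv : (cplx (W + B))⁻¹ = cplx ((W + B)⁻¹) := by
      apply Matrix.inv_eq_right_inv
      rw [← aux_cplx_mul, Matrix.mul_inv_of_invertible]
      ext i j; by_cases hij : i = j <;> simp [cplx, hij, Matrix.one_apply]
    rw [hinv] at h2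
    suffices e : cplx (A - C * (W + B)⁻¹ * Cᵀ) + Complex.I • cplx O1 =
        cplx A + Complex.I • cplx O1 - C.map (fun x => (x : ℂ)) * cplx ((W + B)⁻¹) *
          (C.map (fun x => (x : ℂ)))ᴴ by
      unfold BonaFide; rw [e]; exact h2
    ext i j
    simp [cplx, Matrix.mul_apply]
    ring
  · intro V
    rw [Matrix.fromBlocks_add, zero_add, zero_add, Matrix.det_fromBlocks₂₂, Matrix.invOf_eq_nonsing_inv]
    congr 2
    abel

/-- Split off the `j`-th fibre of a sigma type. -/
def auxEquiv {J : Type*} [DecidableEq J] (n : J → Type*) (j : J) :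
    n j ⊕ {x : Σ k, n k // x.1 ≠ j} ≃ Σ k, n k :=
  Equiv.ofBijective (Sum.elim (fun a => ⟨j, a⟩) Subtype.val) (by
    constructor
    · rintro (a | ⟨a, ha⟩) (b | ⟨b, hb⟩) h
      · simp at h; rw [h]
      · simp at h; subst h; exact absurd rfl hb
      · simp at h; subst h; exact absurd rfl ha
      · simp at h; subst h; rfl
    · rintro ⟨k, a⟩
      by_cases hk : k = j
      · subst hk; exact ⟨Sum.inl a, rfl⟩
      · exact ⟨Sum.inr ⟨⟨k, a⟩, hk⟩, rfl⟩)

lemma aux_sub {J : Type*} [DecidableEq J] {n : J → Type*}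
    (W : ∀ j, Matrix (n j) (n j) ℝ) (j : J) (V : Matrix (n j) (n j) ℝ) :
    (blockDiagonal' (Function.update W j V)).submatrix (auxEquiv n j) (auxEquiv n j) =
      fromBlocks V 0 0 ((blockDiagonal' W).submatrix Subtype.val Subtype.val) := by
  ext (a | ⟨⟨k, a⟩, hk⟩) (b | ⟨⟨l, b⟩, hl⟩)
  · change blockDiagonal' (Function.update W j V) ⟨j, a⟩ ⟨j, b⟩ = V a b
    simp
  · exact blockDiagonal'_apply_ne _ _ _ (Ne.symm hl)
  · exact blockDiagonal'_apply_ne _ _ _ hk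
  · change blockDiagonal' (Function.update W j V) ⟨k, a⟩ ⟨l, b⟩ = blockDiagonal' W ⟨k, a⟩ ⟨l, b⟩
    by_cases hkl : k = l
    · subst hkl
      have : k ≠ j := hk
      simp [this]
    · rw [blockDiagonal'_apply_ne _ _ _ hkl, blockDiagonal'_apply_ne _ _ _ hkl]

lemma aux_step {J : Type*} [Fintype J] [DecidableEq J] {n : J → Type*}
    [∀ j, Fintype (n j)] [∀ j, DecidableEq (n j)] (W O : ∀ j, Matrix (n j) (n j) ℝ)
    (hW : ∀ j, (W j).IsSymm) (hO : ∀ j, (O j)ᵀ = - O j) (hO2 : ∀ j, O j * O j = -1)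
    (hbf : ∀ j, BonaFide (W j) (O j)) (γ : Matrix (Σ j, n j) (Σ j, n j) ℝ) (hγ : γ.IsSymm)
    (hγb : BonaFide γ (blockDiagonal' O)) (j : J) :
    ∃ γ' : Matrix (n j) (n j) ℝ, γ'.IsSymm ∧ BonaFide γ' (O j) ∧ ∃ d : ℝ, 0 < d ∧
      ∀ V, (blockDiagonal' (Function.update W j V) + γ).det = d * (V + γ').det := by
  have hWs : (blockDiagonal' W).IsSymm := by
    unfold Matrix.IsSymm
    rw [blockDiagonal'_transpose]; congr 1; ext1 k; exact hW k
  have hOs : (blockDiagonal' O)ᵀ = - blockDiagonal' O := by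
    rw [blockDiagonal'_transpose, ← blockDiagonal'_neg]; congr 1; ext1 k; exact hO k
  have hOs2 : blockDiagonal' O * blockDiagonal' O = -1 := by
    rw [← blockDiagonal'_mul, ← blockDiagonal'_one, ← blockDiagonal'_neg]
    congr 1; ext1 k; exact hO2 k
  have hWb := aux_bd_bf W O hbf
  have p1 := aux_bf_posDef hWs hOs hOs2 hWb
  have p2 := aux_bf_posDef hγ hOs hOs2 hγb
  have p3 := aux_bf_neg hWs hOs hWb
  set e := auxEquiv n j with he
  have hg : γ.submatrix e e = fromBlocks (γ.submatrix e e).toBlocks₁₁ (γ.submatrix e e).toBlocks₁₂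
      ((γ.submatrix e e).toBlocks₁₂)ᵀ (γ.submatrix e e).toBlocks₂₂ := by
    conv_lhs => rw [← fromBlocks_toBlocks (γ.submatrix e e)]
    congr 1
    ext a b
    exact hγ.apply _ _
  have hOm : (blockDiagonal' O).submatrix e e = fromBlocks (O j) 0 0
      ((blockDiagonal' O).submatrix Subtype.val Subtype.val) := by
    have := aux_sub O j (O j)
    rwa [Function.update_eq_self] at this
  have hval : Function.Injective (Subtype.val : {x : Σ k, n k // x.1 ≠ j} → _) :=
    Subtype.val_injective
  have k1 : (γ.submatrix e e).toBlocks₁₁.IsSymm := by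
    ext a b; exact hγ.apply _ _
  have k2 : BonaFide (fromBlocks (γ.submatrix e e).toBlocks₁₁ (γ.submatrix e e).toBlocks₁₂
      ((γ.submatrix e e).toBlocks₁₂)ᵀ (γ.submatrix e e).toBlocks₂₂) (fromBlocks (O j) 0 0
      ((blockDiagonal' O).submatrix Subtype.val Subtype.val)) := by
    rw [← hg, ← hOm]
    exact hγb.submatrix e
  have k3 : (cplx ((blockDiagonal' W).submatrix Subtype.val Subtype.val +
      (γ.submatrix e e).toBlocks₂₂)).PosDef := by
    rw [aux_cplx_add]
    exact (p1.add p2).submatrix hval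
  obtain ⟨γ', h1, h2, d, hd, h3⟩ := aux_schur _ _ _ _ _ _ k1 k2 k3 (p3.submatrix _)
  refine ⟨γ', h1, h2, d, hd, fun V => ?_⟩
  rw [← h3, ← hg, ← aux_sub, ← det_submatrix_equiv_self e, submatrix_add]
  rfl

lemma aux_det_step {J : Type*} [Fintype J] [DecidableEq J] {n : J → Type*}
    [∀ j, Fintype (n j)] [∀ j, DecidableEq (n j)] (W : ∀ j, Matrix (n j) (n j) ℝ) (j : J)
    (V : Matrix (n j) (n j) ℝ) :
    (blockDiagonal' (Function.update W j V)).det =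
      V.det * (blockDiagonal' (Function.update W j 1)).det := by
  rw [← det_submatrix_equiv_self (auxEquiv n j), ← det_submatrix_equiv_self (auxEquiv n j)
    (blockDiagonal' (Function.update W j 1)), aux_sub, aux_sub, det_fromBlocks_zero₂₁,
    det_fromBlocks_zero₂₁, det_one, one_mul]

lemma aux_det_bd {J : Type*} [Fintype J] [DecidableEq J] {n : J → Type*}
    [∀ j, Fintype (n j)] [∀ j, DecidableEq (n j)] (W : ∀ j, Matrix (n j) (n j) ℝ) :
    (blockDiagonal' W).det = ∏ j, (W j).det := by
  have key : ∀ S : Finset J, (blockDiagonal' (fun k => if k ∈ S then W k else 1)).det =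
      ∏ j ∈ S, (W j).det := by
    intro S
    induction S using Finset.induction_on with
    | empty =>
      have : (blockDiagonal' (fun k => if k ∈ (∅ : Finset J) then W k else 1)) = 1 := by
        simp only [Finset.notMem_empty, if_false]
        exact blockDiagonal'_one
      rw [this]; simp
    | insert a S ha ih =>
      have e1 : (fun k => if k ∈ insert a S then W k else 1) =
          Function.update (fun k => if k ∈ S then W k else 1) a (W a) := by
        ext1 k
        by_cases hk : k = a
        · subst hk; simp
        · simp [hk]
      have e2 : (fun k => if k ∈ S then W k else 1) =
          Function.update (fun k => if k ∈ S then W k else 1) a 1 := by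
        ext1 k
        by_cases hk : k = a
        · subst hk; simp [ha]
        · simp [hk]
      rw [e1, aux_det_step, ← e2, ih, Finset.prod_insert ha]
  simpa using key Finset.univ

lemma aux_factor {n : Type*} [Fintype n] [DecidableEq n] {B : Matrix n n ℝ} (hB : B.PosDef) :
    ∃ S : Matrix n n ℝ, IsUnit S ∧ B = Sᴴ * S := by
  have : ∃ S : Matrix n n ℝ, B = Sᴴ * S := by
    open scoped MatrixOrder in
    exact CStarAlgebra.nonneg_iff_eq_star_mul_self.mp hB.posSemidef.nonneg
  obtain ⟨S, hS⟩ := this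
  refine ⟨S, ?_, hS⟩
  have h1 := hB.isUnit
  rw [Matrix.isUnit_iff_isUnit_det, hS, det_mul] at h1
  rw [Matrix.isUnit_iff_isUnit_det]
  exact isUnit_of_mul_isUnit_right h1

lemma aux_det_one {n : Type*} [Fintype n] [DecidableEq n] {M : Matrix n n ℝ}
    (hM : (M - 1).PosSemidef) : 1 ≤ M.det := by
  have hH : M.IsHermitian := by
    have := hM.1.add (Matrix.isHermitian_one (n := n) (α := ℝ))
    simpa using this
  rw [hH.det_eq_prod_eigenvalues]
  have : ∀ i, 1 ≤ hH.eigenvalues i := by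
    intro i
    have h1 := hM.dotProduct_mulVec_nonneg (⇑(hH.eigenvectorBasis i))
    rw [sub_mulVec, hH.mulVec_eigenvectorBasis, one_mulVec, dotProduct_sub, dotProduct_smul] at h1
    have h2 : star (⇑(hH.eigenvectorBasis i)) ⬝ᵥ (⇑(hH.eigenvectorBasis i)) = (1 : ℝ) := by
      have := hH.eigenvectorBasis.orthonormal.1 i
      rw [dotProduct_comm, ← EuclideanSpace.inner_eq_star_dotProduct, real_inner_self_eq_norm_sq, this]
      norm_num
    rw [h2] at h1
    simpa using h1
  calc (1 : ℝ) = ∏ i : n, (1 : ℝ) := by simp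
    _ ≤ _ := Finset.prod_le_prod (fun _ _ => zero_le_one) fun i _ => this i

lemma aux_det_mono {n : Type*} [Fintype n] [DecidableEq n] {A B : Matrix n n ℝ}
    (hB : B.PosDef) (h : (A - B).PosSemidef) : B.det ≤ A.det := by
  obtain ⟨S, hS, rfl⟩ := aux_factor hB
  have hd := (Matrix.isUnit_iff_isUnit_det _).1 hS
  have hd' : IsUnit Sᴴ.det := by rw [det_conjTranspose]; exact hd.star
  have e : A = Sᴴ * ((S⁻¹)ᴴ * A * S⁻¹) * S := by
    rw [Matrix.conjTranspose_nonsing_inv]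
    simp only [Matrix.mul_assoc]
    rw [Matrix.nonsing_inv_mul _ hd, Matrix.mul_one, Matrix.mul_nonsing_inv_cancel_left _ _ hd']
  have h1 := h.conjTranspose_mul_mul_same S⁻¹
  have h2 : (S⁻¹)ᴴ * (A - Sᴴ * S) * S⁻¹ = (S⁻¹)ᴴ * A * S⁻¹ - 1 := by
    rw [Matrix.mul_sub, Matrix.sub_mul, Matrix.conjTranspose_nonsing_inv,
      Matrix.nonsing_inv_mul_cancel_left _ _ hd', Matrix.mul_nonsing_inv _ hd]
  rw [h2] at h1
  have h3 := aux_det_one h1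
  rw [e, det_mul, det_mul, det_mul, det_conjTranspose, star_trivial]
  nlinarith [mul_self_nonneg S.det]

lemma aux_scalar {n : Type*} [Fintype n] [DecidableEq n] {M : Matrix n n ℝ}
    (hM : M.IsHermitian) : ∃ c : ℝ, 1 ≤ c ∧ (c • (1 : Matrix n n ℝ) - M).PosSemidef := by
  refine ⟨1 + ∑ i, ∑ j, |M i j|, ?_, ?_⟩
  · have : 0 ≤ ∑ i, ∑ j, |M i j| := Finset.sum_nonneg fun i _ => Finset.sum_nonneg fun j _ => abs_nonneg _
    linarith
  refine Matrix.PosSemidef.of_dotProduct_mulVec_nonneg ?_ ?_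
  · exact (Matrix.isHermitian_one.smul (by simp [IsSelfAdjoint])).sub hM
  · intro x
    rw [sub_mulVec, smul_mulVec, one_mulVec, dotProduct_sub, dotProduct_smul]
    have hq : star x ⬝ᵥ M *ᵥ x ≤ (∑ i, ∑ j, |M i j|) * (star x ⬝ᵥ x) := by
      simp only [dotProduct, mulVec, Finset.mul_sum, star_trivial]
      rw [← Finset.mul_sum, Finset.sum_mul]
      refine Finset.sum_le_sum fun i _ => ?_
      rw [Finset.sum_mul]
      refine Finset.sum_le_sum fun j _ => ?_
      have a : ∀ k, x k ^ 2 ≤ ∑ k, x k * x k := fun k => by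
        have := Finset.single_le_sum (f := fun k => x k * x k) (fun k _ => mul_self_nonneg (x k))
          (Finset.mem_univ k)
        simpa [sq] using this
      have b : |x i * x j| ≤ ∑ k, x k * x k := by
        have h1 := a i
        have h2 := a j
        rw [abs_le]; constructor <;> nlinarith [sq_nonneg (x i + x j), sq_nonneg (x i - x j)]
      calc x i * (M i j * x j) = M i j * (x i * x j) := by ring
        _ ≤ |M i j * (x i * x j)| := le_abs_self _
        _ = |M i j| * |x i * x j| := abs_mul _ _
        _ ≤ _ := mul_le_mul_of_nonneg_left b (abs_nonneg _)
    have h0 : 0 ≤ star x ⬝ᵥ x := dotProduct_star_self_nonneg x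
    simp only [smul_eq_mul]
    linarith [h0, hq]

lemma aux_bdd {n : Type*} [Fintype n] [DecidableEq n] {R S Om : Matrix n n ℝ}
    (hO : Omᵀ = -Om) (hO2 : Om * Om = -1) (hR : R.PosDef) (hS : S.PosDef) :
    BddAbove {x : ℝ | ∃ γ : Matrix n n ℝ, γ.IsSymm ∧ BonaFide γ Om ∧
      x = (1/2) * Real.log ((S + γ).det / (R + γ).det)} := by
  obtain ⟨T, hT, hRT⟩ := aux_factor hR
  have hd := (Matrix.isUnit_iff_isUnit_det _).1 hT
  have hd' : IsUnit Tᴴ.det := by rw [det_conjTranspose]; exact hd.star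
  obtain ⟨c, hc1, hc⟩ := aux_scalar (M := (T⁻¹)ᴴ * S * T⁻¹)
    (Matrix.isHermitian_conjTranspose_mul_mul _ hS.1)
  have hcR : (c • R - S).PosSemidef := by
    have h1 := hc.conjTranspose_mul_mul_same T
    have e : Tᴴ * (c • (1 : Matrix n n ℝ) - (T⁻¹)ᴴ * S * T⁻¹) * T = c • R - S := by
      rw [Matrix.mul_sub, Matrix.sub_mul, hRT]
      congr 1
      · simp
      · rw [Matrix.conjTranspose_nonsing_inv]
        simp only [Matrix.mul_assoc]
        rw [Matrix.nonsing_inv_mul _ hd, Matrix.mul_one,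
          Matrix.mul_nonsing_inv_cancel_left _ _ hd']
    rwa [e] at h1
  refine ⟨(1/2) * Real.log (c ^ Fintype.card n), ?_⟩
  rintro x ⟨γ, hγ, hγb, rfl⟩
  have hg := aux_real_posDef (aux_bf_posDef hγ hO hO2 hγb)
  have p1 := (hR.add hg).det_pos
  have p2 := (hS.add hg).det_pos
  have hm : (S + γ).det ≤ (c • (R + γ)).det := by
    refine aux_det_mono (hS.add hg) ?_
    have : c • (R + γ) - (S + γ) = (c • R - S) + (c - 1) • γ := by
      rw [smul_add, sub_smul, one_smul]; abel
    rw [this]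
    exact hcR.add (hg.posSemidef.smul (by linarith))
  rw [det_smul] at hm
  have : (S + γ).det / (R + γ).det ≤ c ^ Fintype.card n := by
    rw [div_le_iff₀ p1]; exact hm
  have := Real.log_le_log (div_pos p2 p1) this
  linarith

/-- the Gaussian measured max-relative entropy is additive over blocks of a
block-diagonal pair of covariance matrices. -/
theorem GDmax_blockDiagonal_additive {J : Type*} [Fintype J] [DecidableEq J]
    (N : J → ℕ) (hN : ∀ j, 1 ≤ N j)
    (Vρ Vσ : (j : J) → Matrix (Fin (2 * N j)) (Fin (2 * N j)) ℝ)
    (hρsymm : ∀ j, (Vρ j).IsSymm) (hσsymm : ∀ j, (Vσ j).IsSymm)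
    (hρbf : ∀ j, BonaFide (Vρ j) (symp (N j)))
    (hdiff : ∀ j, (Vσ j - Vρ j).PosDef) :
    GDmax (Matrix.blockDiagonal' Vρ) (Matrix.blockDiagonal' Vσ)
        (Matrix.blockDiagonal' fun j => symp (N j))
      = ∑ j : J, GDmax (Vρ j) (Vσ j) (symp (N j)) := by
  classical
  have hO : ∀ j, (symp (N j))ᵀ = - symp (N j) := fun j => aux_symp_transpose _
  have hO2 : ∀ j, symp (N j) * symp (N j) = -1 := fun j => aux_symp_sq _
  have hσbf : ∀ j, BonaFide (Vσ j) (symp (N j)) := by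
    intro j
    have h1 := (hρbf j).add (aux_cplx_posSemidef (hdiff j).posSemidef)
    rw [aux_cplx_sub] at h1
    have e : cplx (Vρ j) + Complex.I • cplx (symp (N j)) + (cplx (Vσ j) - cplx (Vρ j)) =
      cplx (Vσ j) + Complex.I • cplx (symp (N j)) := by abel
    rwa [e] at h1
  have hρpd : ∀ j, (Vρ j).PosDef := fun j =>
    aux_real_posDef (aux_bf_posDef (hρsymm j) (hO j) (hO2 j) (hρbf j))
  have hσpd : ∀ j, (Vσ j).PosDef := fun j =>
    aux_real_posDef (aux_bf_posDef (hσsymm j) (hO j) (hO2 j) (hσbf j))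
  have hgpd : ∀ j, ∀ γ : Matrix (Fin (2 * N j)) (Fin (2 * N j)) ℝ, γ.IsSymm →
      BonaFide γ (symp (N j)) → γ.PosDef := fun j γ h1 h2 =>
    aux_real_posDef (aux_bf_posDef h1 (hO j) (hO2 j) h2)
  have hbdd := fun j => aux_bdd (hO j) (hO2 j) (hρpd j) (hσpd j)
  have hle : ∀ j, ∀ γ : Matrix (Fin (2 * N j)) (Fin (2 * N j)) ℝ, γ.IsSymm →
      BonaFide γ (symp (N j)) →
      (1/2) * Real.log ((Vσ j + γ).det / (Vρ j + γ).det) ≤ GDmax (Vρ j) (Vσ j) (symp (N j)) :=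
    fun j γ h1 h2 => le_csSup (hbdd j) ⟨γ, h1, h2, rfl⟩
  -- upper bound
  have hub : ∀ γ : Matrix (Σ j, Fin (2 * N j)) (Σ j, Fin (2 * N j)) ℝ, γ.IsSymm →
      BonaFide γ (blockDiagonal' fun j => symp (N j)) →
      (1/2) * Real.log ((blockDiagonal' Vσ + γ).det / (blockDiagonal' Vρ + γ).det) ≤
        ∑ j : J, GDmax (Vρ j) (Vσ j) (symp (N j)) := by
    intro γ hγ hγb
    have hOs : (blockDiagonal' fun j => symp (N j))ᵀ = - blockDiagonal' fun j => symp (N j) := by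
      rw [blockDiagonal'_transpose, ← blockDiagonal'_neg]; congr 1; ext1 k; exact hO k
    have hOs2 : (blockDiagonal' fun j => symp (N j)) * (blockDiagonal' fun j => symp (N j)) = -1 := by
      rw [← blockDiagonal'_mul, ← blockDiagonal'_one, ← blockDiagonal'_neg]
      congr 1; ext1 k; exact hO2 k
    have hγpd := aux_real_posDef (aux_bf_posDef hγ hOs hOs2 hγb)
    have hpos : ∀ W : (j : J) → Matrix (Fin (2 * N j)) (Fin (2 * N j)) ℝ, (∀ j, (W j).IsSymm) →
        (∀ j, BonaFide (W j) (symp (N j))) → 0 < (blockDiagonal' W + γ).det := by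
      intro W h1 h2
      have hWs : (blockDiagonal' W).IsSymm := by
        unfold Matrix.IsSymm
        rw [blockDiagonal'_transpose]; congr 1; ext1 k; exact h1 k
      exact ((aux_real_posDef (aux_bf_posDef hWs hOs hOs2 (aux_bd_bf _ _ h2))).add hγpd).det_pos
    have key : ∀ S : Finset J,
        (1/2) * Real.log ((blockDiagonal' (fun k => if k ∈ S then Vσ k else Vρ k) + γ).det /
          (blockDiagonal' Vρ + γ).det) ≤ ∑ j ∈ S, GDmax (Vρ j) (Vσ j) (symp (N j)) := by
      intro S
      induction S using Finset.induction_on with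
      | empty =>
        simp only [Finset.notMem_empty, if_false, Finset.sum_empty]
        rw [div_self (hpos _ hρsymm hρbf).ne']
        simp
      | insert a S ha ih =>
        set W : (j : J) → Matrix (Fin (2 * N j)) (Fin (2 * N j)) ℝ :=
          fun k => if k ∈ S then Vσ k else Vρ k with hWdef
        have hWs : ∀ k, (W k).IsSymm := by
          intro k; simp only [hWdef]; split_ifs
          · exact hσsymm k
          · exact hρsymm k
        have hWb : ∀ k, BonaFide (W k) (symp (N k)) := by
          intro k; simp only [hWdef]; split_ifs
          · exact hσbf k
          · exact hρbf k
        have e1 : (fun k => if k ∈ insert a S then Vσ k else Vρ k) =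
            Function.update W a (Vσ a) := by
          ext1 k
          by_cases hk : k = a
          · subst hk; simp
          · simp [hk, hWdef]
        have e2 : W = Function.update W a (Vρ a) := by
          ext1 k
          by_cases hk : k = a
          · subst hk; simp [ha, hWdef]
          · simp [hk]
        obtain ⟨γ', h1, h2, d, hd, h3⟩ := aux_step W (fun j => symp (N j)) hWs hO hO2 hWb γ hγ hγb a
        have g1 := hle a γ' h1 h2
        have q1 := ((hσpd a).add (hgpd a γ' h1 h2)).det_pos
        have q2 := ((hρpd a).add (hgpd a γ' h1 h2)).det_pos
        have q3 := hpos _ hρsymm hρbf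
        have f2 : (blockDiagonal' W + γ).det = d * (Vρ a + γ').det := by
          rw [← h3 (Vρ a), ← e2]
        rw [f2, Real.log_div (mul_pos hd q2).ne' q3.ne', Real.log_mul hd.ne' q2.ne'] at ih
        rw [Real.log_div q1.ne' q2.ne'] at g1
        rw [Finset.sum_insert ha, e1, h3, Real.log_div (mul_pos hd q1).ne' q3.ne',
          Real.log_mul hd.ne' q1.ne']
        linarith
    simpa using key Finset.univ
  have hlow : ∀ g : (j : J) → Matrix (Fin (2 * N j)) (Fin (2 * N j)) ℝ, (∀ j, (g j).IsSymm) →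
      (∀ j, BonaFide (g j) (symp (N j))) →
      ∑ j, (1/2) * Real.log ((Vσ j + g j).det / (Vρ j + g j).det) ≤
        GDmax (blockDiagonal' Vρ) (blockDiagonal' Vσ) (blockDiagonal' fun j => symp (N j)) := by
    intro g h1 h2
    refine le_csSup ⟨∑ j : J, GDmax (Vρ j) (Vσ j) (symp (N j)), ?_⟩
      ⟨blockDiagonal' g, ?_, aux_bd_bf _ _ h2, ?_⟩
    · rintro x ⟨γ, hγ, hγb, rfl⟩
      exact hub γ hγ hγb
    · unfold Matrix.IsSymm
      rw [blockDiagonal'_transpose]; congr 1; ext1 k; exact h1 k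
    · rw [← blockDiagonal'_add, ← blockDiagonal'_add, aux_det_bd, aux_det_bd,
        ← Finset.prod_div_distrib, Real.log_prod, Finset.mul_sum]
      · rfl
      · intro j _
        exact (div_pos ((hσpd j).add (hgpd j _ (h1 j) (h2 j))).det_pos
          ((hρpd j).add (hgpd j _ (h1 j) (h2 j))).det_pos).ne'
  apply le_antisymm
  · refine csSup_le ⟨_, blockDiagonal' Vρ, ?_, aux_bd_bf _ _ hρbf, rfl⟩ ?_
    · unfold Matrix.IsSymm
      rw [blockDiagonal'_transpose]; congr 1; ext1 k; exact hρsymm k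
    · rintro x ⟨γ, hγ, hγb, rfl⟩
      exact hub γ hγ hγb
  · refine le_of_forall_pos_le_add fun ε hε => ?_
    have hδ : 0 < ε / (Fintype.card J + 1) := by positivity
    have hex : ∀ j, ∃ γ : Matrix (Fin (2 * N j)) (Fin (2 * N j)) ℝ, γ.IsSymm ∧
        BonaFide γ (symp (N j)) ∧ GDmax (Vρ j) (Vσ j) (symp (N j)) - ε / (Fintype.card J + 1) <
          (1/2) * Real.log ((Vσ j + γ).det / (Vρ j + γ).det) := by
      intro j
      obtain ⟨x, ⟨γ, h1, h2, rfl⟩, h3⟩ := exists_lt_of_lt_csSup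
        (s := {x : ℝ | ∃ γ : Matrix (Fin (2 * N j)) (Fin (2 * N j)) ℝ, γ.IsSymm ∧
          BonaFide γ (symp (N j)) ∧ x = (1/2) * Real.log ((Vσ j + γ).det / (Vρ j + γ).det)})
        ⟨_, Vρ j, hρsymm j, hρbf j, rfl⟩
        (show GDmax (Vρ j) (Vσ j) (symp (N j)) - ε / (Fintype.card J + 1) < _ from
          sub_lt_self _ hδ)
      exact ⟨γ, h1, h2, h3⟩
    choose g g1 g2 g3 using hex
    have h4 := hlow g g1 g2
    have h5 := Finset.sum_le_sum (s := Finset.univ) fun j _ => (g3 j).le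
    rw [Finset.sum_sub_distrib, Finset.sum_const, Finset.card_univ, nsmul_eq_mul] at h5
    have h6 : (Fintype.card J : ℝ) * (ε / (Fintype.card J + 1)) ≤ ε := by
      rw [mul_div_assoc', div_le_iff₀ (by positivity)]
      nlinarith
    linarith
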